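/- arXiv:2408.03919 — 2 statements merged into one kernel-verified Lean document; each statement's English description precedes it below -/
import Mathlib

section
/- There exists an absolute constant C ≥ 1 such that the following holds. Let κ > 0, M = C·κ⁻¹, J₀ ∈ Δ(𝕋), let G ⊂ J₀ be measurable with ℋ¹(G) > 0, and let E ⊂ ℝ² be a finite union of parallel segments; set μ = ℋ¹|_E and assume ℋ¹(π_θ(E)) > κ·μ(E) for all θ ∈ G. Then there exists a measurable set E' ⊂ E such that: (1) μ(E') ≥ (κ/4)·μ(E); (2) for every x ∈ E' there is a finite family 𝒢(x) of pairwise disjoint triadic subintervals of J₀ whose union G(x) satisfies ℋ¹(G(x)) ≥ (κ/5)·ℋ¹(G); (3) for every x ∈ E' and every I ∈ 𝒢(x) there exists θ_I ∈ I with μ_{θ_I}(x) ≤ M; (4) for every x ∈ E', ∫₀^∞ μ(X(x,G(x)^⊥,r))·r⁻² dr ≤ C·M·ℋ¹(G). -/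
open MeasureTheory Metric Set
open scoped ENNReal NNReal

noncomputable section

abbrev R2 := EuclideanSpace ℝ (Fin 2)

/-- The unit vector in direction `2πθ`. -/
def dir (θ : ℝ) : R2 :=
  (EuclideanSpace.equiv (Fin 2) ℝ).symm ![Real.cos (2 * Real.pi * θ), Real.sin (2 * Real.pi * θ)]

/-- Orthogonal projection `π_θ`. -/
def proj (θ : ℝ) (x : R2) : ℝ :=
  x 0 * Real.cos (2 * Real.pi * θ) + x 1 * Real.sin (2 * Real.pi * θ)

/-- `π_θ^⊥ = π_{θ+1/4}`. -/
def projPerp (θ : ℝ) (x : R2) : ℝ := proj (θ + 1/4) x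

/-- Favard length. -/
def Fav (E : Set R2) : ℝ≥0∞ := ∫⁻ θ in Set.Icc (0:ℝ) 1, μH[1] (proj θ '' E)

/-- Ahlfors regularity with constant `A`. -/
def AhlforsRegular (A : ℝ) (E : Set R2) : Prop :=
  IsClosed E ∧ ∀ x ∈ E, ∀ r : ℝ, 0 < r → ENNReal.ofReal r < EMetric.diam E →
    ENNReal.ofReal (A⁻¹ * r) ≤ μH[1] (E ∩ ball x r) ∧
      μH[1] (E ∩ ball x r) ≤ ENNReal.ofReal (A * r)

/-- A Lipschitz graph with constant `L`: rotated graph of an `L`-Lipschitz function. -/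
def IsLipschitzGraph (L : ℝ) (Γ : Set R2) : Prop :=
  ∃ (R : R2 ≃ₗᵢ[ℝ] R2) (f : ℝ → ℝ), LipschitzWith (Real.toNNReal L) f ∧
    Γ = R '' {x : R2 | x 1 = f (x 0)}

/-- The (untruncated) cone `X(x,G)`. -/
def cone (x : R2) (G : Set ℝ) : Set R2 := ⋃ θ ∈ G, {y | ∃ t : ℝ, y = x + t • dir θ}

/-- The truncated cone `X(x,G,r)`. -/
def coneT (x : R2) (G : Set ℝ) (r : ℝ) : Set R2 := cone x G ∩ ball x r

/-- The doubly truncated cone `X(x,G,r,R)`. -/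
def coneA (x : R2) (G : Set ℝ) (r R : ℝ) : Set R2 := coneT x G R \ ball x r

/-- Hardy–Littlewood maximal function of a measure on `ℝ`. -/
def maximalFn (ν : Measure ℝ) (t : ℝ) : ℝ≥0∞ :=
  ⨆ (r : ℝ) (_ : 0 < r), ν (Set.Ioo (t - r) (t + r)) / ENNReal.ofReal (2 * r)

/-- `μ_θ(x) = M(π_θ μ)(π_θ x)`. -/
def projMax (μ : Measure R2) (θ : ℝ) (x : R2) : ℝ≥0∞ :=
  maximalFn (μ.map (proj θ)) (proj θ x)

/-- `μ_θ^⊥(x) = M(π_θ^⊥ μ)(π_θ^⊥ x)`. -/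
def projMaxPerp (μ : Measure R2) (θ : ℝ) (x : R2) : ℝ≥0∞ :=
  maximalFn (μ.map (projPerp θ)) (projPerp θ x)

/-- The interval with center `c` and length `ℓ`. -/
def itv (c ℓ : ℝ) : Set ℝ := Set.Icc (c - ℓ/2) (c + ℓ/2)

/-- The metric `d_I` associated to the interval with center `c` and length `ℓ`. -/
def dmet (c ℓ : ℝ) (x y : R2) : ℝ :=
  Real.sqrt ((ℓ^2)⁻¹ * (projPerp c x - projPerp c y)^2 + (proj c x - proj c y)^2)

/-- The open `d_I`-ball `B_I(x,r)`. -/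
def bmet (c ℓ : ℝ) (x : R2) (r : ℝ) : Set R2 := {y | dmet c ℓ x y < r}

/-- Triadic intervals of `[0,1)`. -/
def IsTriadic (I : Set ℝ) : Prop :=
  ∃ (j k : ℕ), k < 3^j ∧ I = Set.Ico ((k : ℝ)/3^j) ((k+1 : ℝ)/3^j)

/-- 1-dimensional Hausdorff content. -/
def hContent {X : Type*} [EMetricSpace X] (s : Set X) : ℝ≥0∞ :=
  ⨅ (t : ℕ → Set X) (_ : s ⊆ ⋃ n, t n), ∑' n, EMetric.diam (t n)

/-- `E` is a finite union of parallel segments. -/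
def FinUnionParallelSegments (E : Set R2) : Prop :=
  ∃ (n : ℕ) (d : R2) (p q : Fin n → R2), d ≠ 0 ∧
    (∀ i, ∃ t : ℝ, q i - p i = t • d) ∧ E = ⋃ i, segment ℝ (p i) (q i)

open Filter Topology

/-! ### Projections -/

lemma dir_zero (θ : ℝ) : dir θ 0 = Real.cos (2 * Real.pi * θ) := by simp [dir]

lemma dir_one (θ : ℝ) : dir θ 1 = Real.sin (2 * Real.pi * θ) := by simp [dir]

lemma continuous_proj_uncurry : Continuous fun z : ℝ × R2 => proj z.1 z.2 := by
  unfold proj; fun_prop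

lemma continuous_proj (θ : ℝ) : Continuous (proj θ) := by
  unfold proj; fun_prop

lemma continuous_proj_left (x : R2) : Continuous fun θ => proj θ x := by
  unfold proj; fun_prop

lemma proj_add (θ : ℝ) (x y : R2) : proj θ (x + y) = proj θ x + proj θ y := by
  simp only [proj, PiLp.add_apply]; ring

lemma proj_sub (θ : ℝ) (x y : R2) : proj θ (x - y) = proj θ x - proj θ y := by
  simp only [proj, PiLp.sub_apply]; ring

lemma proj_smul (θ s : ℝ) (x : R2) : proj θ (s • x) = s * proj θ x := by
  simp only [proj, PiLp.smul_apply, smul_eq_mul]; ring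

lemma norm_sq_R2 (x : R2) : ‖x‖ ^ 2 = x 0 ^ 2 + x 1 ^ 2 := by
  simp [EuclideanSpace.norm_sq_eq]

lemma abs_proj_le (θ : ℝ) (x : R2) : |proj θ x| ≤ ‖x‖ := by
  refine abs_le_of_sq_le_sq ?_ (norm_nonneg x)
  rw [norm_sq_R2, proj]
  nlinarith [Real.sin_sq_add_cos_sq (2 * Real.pi * θ),
    sq_nonneg (x 0 * Real.sin (2 * Real.pi * θ) - x 1 * Real.cos (2 * Real.pi * θ))]

lemma lipschitzWith_proj (θ : ℝ) : LipschitzWith 1 (proj θ) :=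
  LipschitzWith.of_dist_le_mul fun x y => by
    simpa [Real.dist_eq, dist_eq_norm, proj_sub] using abs_proj_le θ (x - y)

/-- Directions perpendicular to each other: `dir (θ + 1/4)` spans the kernel of `proj θ`. -/
lemma proj_dir_add_quarter (θ : ℝ) : proj θ (dir (θ + 1 / 4)) = 0 := by
  have h : 2 * Real.pi * (θ + 1 / 4) = 2 * Real.pi * θ + Real.pi / 2 := by ring
  rw [proj, dir_zero, dir_one, h, Real.cos_add_pi_div_two, Real.sin_add_pi_div_two]
  ring

lemma proj_eq_of_mem_cone {x z : R2} {S : Set ℝ} (hz : z ∈ cone x ((fun θ => θ + 1 / 4) '' S)) :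
    ∃ θ ∈ S, proj θ z = proj θ x := by
  simp only [cone, mem_iUnion, mem_image, mem_ofPred_eq, exists_prop] at hz
  obtain ⟨_, ⟨θ, hθ, rfl⟩, t, rfl⟩ := hz
  exact ⟨θ, hθ, by rw [proj_add, proj_smul, proj_dir_add_quarter, mul_zero, add_zero]⟩

lemma proj_mul_proj_sub (θ θ' : ℝ) (v w : R2) :
    proj θ w * proj θ' v - proj θ' w * proj θ v =
      (w 0 * v 1 - w 1 * v 0) * Real.sin (2 * Real.pi * (θ' - θ)) := by
  rw [mul_sub, Real.sin_sub, proj, proj, proj, proj]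
  ring

lemma abs_cross_of_proj_eq_zero {θ : ℝ} {v w : R2} (hw : proj θ w = 0) :
    |w 0 * v 1 - w 1 * v 0| = ‖w‖ * |proj θ v| := by
  rw [← abs_norm w, ← abs_mul, ← sq_eq_sq_iff_abs_eq_abs, mul_pow, norm_sq_R2]
  unfold proj at *
  have h := Real.sin_sq_add_cos_sq (2 * Real.pi * θ)
  set s := Real.sin (2 * Real.pi * θ)
  set c := Real.cos (2 * Real.pi * θ)
  have h0 : w 0 = -(w 1 * c - w 0 * s) * s := by linear_combination w 0 * (-h) + c * hw
  have h1 : w 1 = (w 1 * c - w 0 * s) * c := by linear_combination w 1 * (-h) + s * hw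
  generalize w 1 * c - w 0 * s = ρ at h0 h1
  rw [h0, h1]
  linear_combination (-(ρ ^ 2 * (v 0 * c + v 1 * s) ^ 2)) * h

lemma volume_proj_eq_zero {w : R2} (hw : w ≠ 0) : volume {θ : ℝ | proj θ w = 0} = 0 := by
  rcases eq_empty_or_nonempty {θ : ℝ | proj θ w = 0} with h | ⟨θ₀, h₀⟩
  · simp [h]
  refine Countable.measure_zero (Countable.mono (s₂ := range fun n : ℤ => θ₀ + n / 2) ?_
    (countable_range _)) _
  intro θ hθ
  simp only [mem_ofPred_eq] at hθ h₀
  have h1 := proj_mul_proj_sub θ₀ θ !₂[-(w 1), w 0] w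
  rw [h₀, hθ] at h1
  have h2 : Real.sin (2 * Real.pi * (θ - θ₀)) = 0 := by
    have h3 : w 0 ^ 2 + w 1 ^ 2 ≠ 0 := by
      rw [← norm_sq_R2]; exact pow_ne_zero 2 (norm_ne_zero_iff.2 hw)
    simp at h1
    rcases h1 with h1 | h1
    · exact absurd (by nlinarith) h3
    · exact h1
  obtain ⟨n, hn⟩ := Real.sin_eq_zero_iff.1 h2
  refine ⟨n, ?_⟩
  have := Real.pi_pos
  simp only
  field_simp at hn
  linarith

/-! ### The maximal function -/

/-- The weak type `(1,1)` inequality. -/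
lemma volume_lt_maximalFn_le (ν : Measure ℝ) [IsFiniteMeasure ν] {l : ℝ} (hl : 0 < l) :
    volume {t | ENNReal.ofReal l < maximalFn ν t} ≤ 5 * ν univ / ENNReal.ofReal l := by
  set S := {t | ENNReal.ofReal l < maximalFn ν t}
  have hS : ∀ t : ℝ, ∃ r : ℝ, t ∈ S → 0 < r ∧
      ENNReal.ofReal (2 * r) * ENNReal.ofReal l ≤ ν (Ioo (t - r) (t + r)) := by
    intro t
    by_cases ht : t ∈ S
    · have ht' : ENNReal.ofReal l < maximalFn ν t := ht
      simp only [maximalFn, lt_iSup_iff] at ht'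
      obtain ⟨r, hr, h⟩ := ht'
      refine ⟨r, fun _ => ⟨hr, ?_⟩⟩
      rw [mul_comm]
      exact ENNReal.mul_le_of_le_div h.le
    · exact ⟨0, fun h => absurd h ht⟩
  choose r hr using hS
  obtain ⟨u, huS, hdisj, hcov⟩ := Vitali.exists_disjoint_subfamily_covering_enlargement_closedBall
    S id r ((ν univ).toReal / (2 * l)) (fun t ht => by
      obtain ⟨h0, h1⟩ := hr t ht
      rw [le_div_iff₀ (by positivity)]
      rw [← ENNReal.ofReal_mul (by positivity)] at h1
      have := (ENNReal.ofReal_le_iff_le_toReal (measure_ne_top ν univ)).1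
        (h1.trans (measure_mono (subset_univ _)))
      linarith) 5 (by norm_num)
  simp only [id] at hdisj hcov
  have hucount : u.Countable := by
    refine hdisj.countable_of_nonempty_interior fun t ht => ?_
    refine ⟨t, ?_⟩
    exact (interior_mono ball_subset_closedBall) (by
      rw [isOpen_ball.interior_eq]; exact mem_ball_self (hr t (huS ht)).1)
  have := hucount.to_subtype
  calc volume S ≤ volume (⋃ t : u, closedBall (t : ℝ) (5 * r t)) := by
        refine measure_mono fun t ht => ?_
        obtain ⟨b, hb, hsub⟩ := hcov t ht
        exact mem_iUnion.2 ⟨⟨b, hb⟩, hsub (mem_closedBall_self (hr t ht).1.le)⟩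
    _ ≤ ∑' t : u, volume (closedBall (t : ℝ) (5 * r t)) := measure_iUnion_le _
    _ ≤ ∑' t : u, 5 / ENNReal.ofReal l * ν (Ioo ((t : ℝ) - r t) (t + r t)) := by
        refine ENNReal.tsum_le_tsum fun t => ?_
        obtain ⟨h0, h1⟩ := hr t (huS t.2)
        rw [Real.volume_closedBall, ENNReal.mul_comm_div,
          show 2 * (5 * r t) = 5 * (2 * r t) by ring, ENNReal.ofReal_mul (by norm_num),
          show ENNReal.ofReal 5 = 5 by norm_num]
        gcongr
        rw [ENNReal.le_div_iff_mul_le (Or.inl (by simpa using hl)) (Or.inl ENNReal.ofReal_ne_top)]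
        exact h1
    _ = 5 / ENNReal.ofReal l * ν (⋃ t : u, Ioo ((t : ℝ) - r t) (t + r t)) := by
        rw [ENNReal.tsum_mul_left, measure_iUnion]
        · intro a b hab
          refine Disjoint.mono ?_ ?_ (hdisj a.2 b.2 (fun h => hab (Subtype.ext h)))
          · exact (Real.ball_eq_Ioo (a : ℝ) (r a)).symm.subset.trans ball_subset_closedBall
          · exact (Real.ball_eq_Ioo (b : ℝ) (r b)).symm.subset.trans ball_subset_closedBall
        · exact fun _ => measurableSet_Ioo
    _ ≤ 5 / ENNReal.ofReal l * ν univ := by gcongr; exact subset_univ _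
    _ = 5 * ν univ / ENNReal.ofReal l := by rw [ENNReal.mul_comm_div, ← mul_div_assoc]

/-- The mass of the open strip of half-width `r` around the line `π_θ = π_θ x`. -/
def stripMass (μ : Measure R2) (r : ℝ) (z : ℝ × R2) : ℝ≥0∞ :=
  μ {y | |proj z.1 y - proj z.1 z.2| < r}

lemma map_proj_Ioo (μ : Measure R2) (r : ℝ) (z : ℝ × R2) :
    μ.map (proj z.1) (Ioo (proj z.1 z.2 - r) (proj z.1 z.2 + r)) = stripMass μ r z := by
  rw [Measure.map_apply (continuous_proj _).measurable measurableSet_Ioo, stripMass]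
  congr 1
  ext y
  rw [mem_preimage, ← Real.ball_eq_Ioo, mem_ball, Real.dist_eq, mem_ofPred_eq]

lemma projMax_eq (μ : Measure R2) (z : ℝ × R2) :
    projMax μ z.1 z.2 = ⨆ (r : ℝ) (_ : 0 < r), stripMass μ r z / ENNReal.ofReal (2 * r) := by
  simp only [projMax, maximalFn, map_proj_Ioo]

lemma measurable_stripMass (μ : Measure R2) [SFinite μ] (r : ℝ) : Measurable (stripMass μ r) := by
  refine measurable_measure_prodMk_left (ν := μ)
    (s := {p : (ℝ × R2) × R2 | |proj p.1.1 p.2 - proj p.1.1 p.1.2| < r}) ?_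
  refine (isOpen_lt ?_ continuous_const).measurableSet
  exact ((continuous_proj_uncurry.comp (by fun_prop : Continuous
    fun p : (ℝ × R2) × R2 => (p.1.1, p.2))).sub (continuous_proj_uncurry.comp
    (by fun_prop : Continuous fun p : (ℝ × R2) × R2 => (p.1.1, p.1.2)))).abs

lemma exists_rat_stripMass (μ : Measure R2) {r : ℝ} (hr : 0 < r) (z : ℝ × R2) :
    ∃ q : ℚ, 0 < (q : ℝ) ∧ stripMass μ r z / ENNReal.ofReal (2 * r) ≤
      2 * (stripMass μ q z / ENNReal.ofReal (2 * q)) := by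
  obtain ⟨q, h1, h2⟩ := exists_rat_btwn (show r < 2 * r by linarith)
  refine ⟨q, hr.trans h1, ?_⟩
  have h3 : stripMass μ r z ≤ stripMass μ q z := measure_mono fun y hy => lt_trans hy h1
  have hq : 0 < (q : ℝ) := hr.trans h1
  have h4 : 2 * (stripMass μ q z / ENNReal.ofReal (2 * q)) = stripMass μ q z / ENNReal.ofReal q := by
    rw [ENNReal.ofReal_mul (by norm_num), ENNReal.ofReal_ofNat, ← mul_div_assoc,
      ENNReal.mul_div_mul_left _ _ (by norm_num) (by norm_num)]
  rw [h4]
  gcongr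

/-- A measurable set containing `{projMax ≤ l}` on which `projMax ≤ 2 * l`. -/
def goodPairs (μ : Measure R2) (l : ℝ) : Set (ℝ × R2) :=
  {z | ∀ q : ℚ, 0 < (q : ℝ) → stripMass μ q z / ENNReal.ofReal (2 * q) ≤ ENNReal.ofReal l}

lemma measurableSet_goodPairs (μ : Measure R2) [SFinite μ] (l : ℝ) :
    MeasurableSet (goodPairs μ l) := by
  simp only [goodPairs, ofPred_forall]
  refine MeasurableSet.iInter fun q => MeasurableSet.iInter fun _ => ?_
  exact measurableSet_le ((measurable_stripMass μ q).div_const _) measurable_const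

lemma projMax_le_of_mem_goodPairs {μ : Measure R2} {l : ℝ} {z : ℝ × R2} (hz : z ∈ goodPairs μ l) :
    projMax μ z.1 z.2 ≤ ENNReal.ofReal (2 * l) := by
  rw [projMax_eq]
  refine iSup₂_le fun r hr => ?_
  obtain ⟨q, hq, h⟩ := exists_rat_stripMass μ hr z
  have h2 : ENNReal.ofReal (2 * l) = 2 * ENNReal.ofReal l := by
    rw [ENNReal.ofReal_mul (by norm_num), ENNReal.ofReal_ofNat]
  rw [h2]
  exact h.trans (mul_le_mul' le_rfl (hz q hq))

lemma lt_projMax_of_notMem_goodPairs {μ : Measure R2} {l : ℝ} {z : ℝ × R2}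
    (hz : z ∉ goodPairs μ l) : ENNReal.ofReal l < projMax μ z.1 z.2 := by
  contrapose! hz
  rw [projMax_eq] at hz
  intro q hq
  exact (le_iSup₂ (f := fun (r : ℝ) (_ : 0 < r) => stripMass μ r z / ENNReal.ofReal (2 * r))
    (q : ℝ) hq).trans hz

/-! ### Conical energy over small intervals of directions -/

lemma lintegral_Ioi_inv_sq {a : ℝ} (ha : 0 < a) :
    ∫⁻ r in Ioi a, (ENNReal.ofReal (r ^ 2))⁻¹ = ENNReal.ofReal a⁻¹ := by
  have h1 : ∫ r in Ioi a, r ^ (-2 : ℝ) = a⁻¹ := by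
    rw [integral_Ioi_rpow_of_lt (by norm_num) ha]
    norm_num [Real.rpow_neg_one]
  rw [← h1, ofReal_integral_eq_lintegral_ofReal (integrableOn_Ioi_rpow_of_lt (by norm_num) ha)]
  · refine setLIntegral_congr_fun measurableSet_Ioi fun r hr => ?_
    have hr0 : 0 < r := ha.trans hr
    rw [← ENNReal.ofReal_inv_of_pos (by positivity), Real.rpow_neg hr0.le, Real.rpow_ofNat]
  · exact (ae_restrict_iff' measurableSet_Ioi).2
      (Eventually.of_forall fun r hr => Real.rpow_nonneg (ha.trans hr).le _)

lemma isCompact_segment_R2 (a b : R2) : IsCompact (segment ℝ a b) := by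
  rw [segment_eq_image_lineMap]
  exact isCompact_Icc.image (by fun_prop)

/-- The parameter at which the line `y + ℝ d` has the same `π_θ`-projection as `x`. -/
def crossing (d x y : R2) (θ : ℝ) : ℝ := proj θ (x - y) / proj θ d

lemma eq_crossing {d x y : R2} {θ s : ℝ} (hd : proj θ d ≠ 0)
    (h : proj θ (y + s • d) = proj θ x) : s = crossing d x y θ := by
  rw [crossing, eq_div_iff hd, proj_sub, ← h, proj_add, proj_smul]
  ring

lemma continuousAt_crossing {d x y : R2} {θ : ℝ} (hd : proj θ d ≠ 0) :
    ContinuousAt (crossing d x y) θ :=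
  (continuous_proj_left _).continuousAt.div (continuous_proj_left _).continuousAt hd

lemma abs_crossing_sub_le {d x y : R2} {θ₀ θ θ' : ℝ} (hd : proj θ₀ d ≠ 0)
    (hxy : proj θ₀ y = proj θ₀ x) (hθ : |proj θ₀ d| / 2 ≤ |proj θ d|)
    (hθ' : |proj θ₀ d| / 2 ≤ |proj θ' d|) :
    |crossing d x y θ - crossing d x y θ'| ≤
      8 * Real.pi * ‖x - y‖ / |proj θ₀ d| * |θ - θ'| := by
  have hc : 0 < |proj θ₀ d| := abs_pos.2 hd
  have h1 : proj θ d ≠ 0 := abs_pos.1 (by linarith)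
  have h2 : proj θ' d ≠ 0 := abs_pos.1 (by linarith)
  have h0 : proj θ₀ (x - y) = 0 := by rw [proj_sub, hxy, sub_self]
  have hsin : |Real.sin (2 * Real.pi * (θ' - θ))| ≤ 2 * Real.pi * |θ - θ'| := by
    refine Real.abs_sin_le_abs.trans ?_
    rw [abs_mul, abs_of_pos Real.two_pi_pos, abs_sub_comm]
  rw [crossing, crossing, div_sub_div _ _ h1 h2, mul_comm (proj θ d), proj_mul_proj_sub, abs_div,
    abs_mul, abs_mul, abs_cross_of_proj_eq_zero h0, div_le_iff₀ (by positivity)]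
  calc ‖x - y‖ * |proj θ₀ d| * |Real.sin (2 * Real.pi * (θ' - θ))|
      ≤ ‖x - y‖ * |proj θ₀ d| * (2 * Real.pi * |θ - θ'|) := by gcongr
    _ = 8 * Real.pi * ‖x - y‖ / |proj θ₀ d| * |θ - θ'| *
        (|proj θ₀ d| / 2 * (|proj θ₀ d| / 2)) := by field_simp; ring
    _ ≤ _ := by gcongr

lemma isometry_line (y : R2) {d : R2} (hd : ‖d‖ = 1) : Isometry fun s : ℝ => y + s • d :=
  Isometry.of_dist_eq fun s t => by
    rw [dist_add_left, dist_eq_norm, ← sub_smul, norm_smul, hd, mul_one, Real.dist_eq,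
      Real.norm_eq_abs]

/-- If finitely many points of the line `π_θ = π_θ x` are interior points of `E` in the
direction `d`, then their number is controlled by `projMax`. -/
lemma card_div_le_projMax {E : Set R2} {x d : R2} {θ ε : ℝ} (Y : Finset R2) (hε : 0 < ε)
    (hd : ‖d‖ = 1) (hθ : proj θ d ≠ 0) (hE : MeasurableSet E)
    (hY : ∀ y ∈ Y, proj θ y = proj θ x)
    (hYE : ∀ y ∈ Y, ∀ s : ℝ, |s| < ε → y + s • d ∈ E) :
    (Y.card : ℝ≥0∞) / ENNReal.ofReal |proj θ d| ≤ projMax (μH[1].restrict E) θ x := by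
  have hc : 0 < |proj θ d| := abs_pos.2 hθ
  have hfin : (Y.card : ℝ≥0∞) * ENNReal.ofReal (2 * ε) ≤
      stripMass (μH[1].restrict E) (ε * |proj θ d|) (θ, x) := by
    have hpiece : ∀ y : R2, μH[1] ((fun s : ℝ => y + s • d) '' Ioo (-ε) ε) =
        ENNReal.ofReal (2 * ε) := fun y => by
      rw [(isometry_line y hd).hausdorffMeasure_image (Or.inl zero_le_one), hausdorffMeasure_real,
        Real.volume_Ioo]
      congr 1; ring
    have hmeas : ∀ y : R2, MeasurableSet ((fun s : ℝ => y + s • d) '' Ioo (-ε) ε) := fun y =>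
      (isometry_line y hd).isClosedEmbedding.measurableEmbedding.measurableSet_image.2
        measurableSet_Ioo
    rw [stripMass, Measure.restrict_apply' hE]
    calc (Y.card : ℝ≥0∞) * ENNReal.ofReal (2 * ε)
        = ∑ y ∈ Y, μH[1] ((fun s : ℝ => y + s • d) '' Ioo (-ε) ε) := by
          simp [hpiece]
      _ = μH[1] (⋃ y ∈ Y, (fun s : ℝ => y + s • d) '' Ioo (-ε) ε) := by
          rw [measure_biUnion_finset _ fun y _ => hmeas y]
          intro y hy y' hy' hne
          refine Set.disjoint_left.2 ?_
          rintro _ ⟨s, -, rfl⟩ ⟨s', -, h⟩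
          simp only at h
          have h1 := congrArg (proj θ) h
          rw [proj_add, proj_add, proj_smul, proj_smul, hY y hy, hY y' hy', add_right_inj] at h1
          rw [mul_right_cancel₀ hθ h1] at h
          exact hne (add_right_cancel h).symm
      _ ≤ _ := by
          refine measure_mono (iUnion₂_subset fun y hy => ?_)
          rintro _ ⟨s, hs, rfl⟩
          have hs' : |s| < ε := abs_lt.2 hs
          refine ⟨?_, hYE y hy s hs'⟩
          simp only [mem_ofPred_eq, proj_add, proj_smul, hY y hy, add_sub_cancel_left, abs_mul]
          gcongr
  rw [projMax_eq _ (θ, x)]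
  refine le_trans ?_ (le_iSup₂ (f := fun (r : ℝ) (_ : 0 < r) =>
    stripMass (μH[1].restrict E) r (θ, x) / ENNReal.ofReal (2 * r)) (ε * |proj θ d|)
    (by positivity))
  rw [← mul_assoc, ENNReal.ofReal_mul (by positivity)]
  calc (Y.card : ℝ≥0∞) / ENNReal.ofReal |proj θ d|
      = ENNReal.ofReal (2 * ε) * Y.card / (ENNReal.ofReal (2 * ε) * ENNReal.ofReal |proj θ d|) := by
        rw [ENNReal.mul_div_mul_left _ _ (by simpa using hε) ENNReal.ofReal_ne_top]
    _ ≤ _ := by rw [mul_comm _ (Y.card : ℝ≥0∞)]; gcongr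

/-- Conical energy of a set `E` meeting the lines under consideration only in `x` and near finitely
many points. -/
lemma lintegral_coneT_le {E : Set R2} {x d : R2} {θ₀ a b : ℝ} (Y : Finset R2)
    (hd : ‖d‖ = 1) (hθ₀ : proj θ₀ d ≠ 0) (hab : a ≤ b) (hE : MeasurableSet E)
    (hY : ∀ y ∈ Y, proj θ₀ y = proj θ₀ x ∧ y ≠ x)
    (hI : ∀ θ ∈ Ico a b, |proj θ₀ d| / 2 ≤ |proj θ d|)
    (hEI : ∀ θ ∈ Ico a b, ∀ z ∈ E, proj θ z = proj θ x → z = x ∨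
      ∃ y ∈ Y, z = y + crossing d x y θ • d ∧ ‖x - y‖ / 2 < ‖x - z‖) :
    ∫⁻ r in Ioi (0 : ℝ), (μH[1].restrict E) (coneT x ((fun θ => θ + 1 / 4) '' Ico a b) r)
        / ENNReal.ofReal (r ^ 2) ≤
      ENNReal.ofReal (16 * Real.pi * (b - a)) * (Y.card / ENNReal.ofReal |proj θ₀ d|) := by
  have hc : 0 < |proj θ₀ d| := abs_pos.2 hθ₀
  set P : R2 → Set R2 := fun y => (fun θ => y + crossing d x y θ • d) '' Ico a b with hP
  have hPm : ∀ y ∈ Y, μH[1] (P y) ≤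
      ENNReal.ofReal (8 * Real.pi * ‖x - y‖ / |proj θ₀ d| * (b - a)) := by
    intro y hy
    have hL : LipschitzOnWith (8 * Real.pi * ‖x - y‖ / |proj θ₀ d|).toNNReal
        (fun θ => y + crossing d x y θ • d) (Ico a b) :=
      LipschitzOnWith.of_dist_le_mul fun θ hθ θ' hθ' => by
        rw [(isometry_line y hd).dist_eq, Real.dist_eq, Real.dist_eq,
          Real.coe_toNNReal _ (by have := Real.pi_pos; positivity)]
        exact abs_crossing_sub_le hθ₀ (hY y hy).1 (hI θ hθ) (hI θ' hθ')
    refine (hL.hausdorffMeasure_image_le zero_le_one).trans ?_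
    rw [hausdorffMeasure_real, Real.volume_Ico, ENNReal.rpow_one,
      ENNReal.ofReal_mul (by have := Real.pi_pos; positivity)]
    rfl
  have hcone : ∀ r : ℝ, (μH[1].restrict E) (coneT x ((fun θ => θ + 1 / 4) '' Ico a b) r) ≤
      ∑ y ∈ Y, (Ioi (‖x - y‖ / 2)).indicator (fun _ => μH[1] (P y)) r := by
    intro r
    rw [Measure.restrict_apply' hE]
    have hsub : coneT x ((fun θ => θ + 1 / 4) '' Ico a b) r ∩ E ⊆
        {x} ∪ ⋃ y ∈ Y, {z | z ∈ P y ∧ ‖x - y‖ / 2 < r} := by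
      rintro z ⟨⟨hz, hzr⟩, hzE⟩
      obtain ⟨θ, hθ, hzθ⟩ := proj_eq_of_mem_cone hz
      rcases hEI θ hθ z hzE hzθ with h | ⟨y, hy, hzy, hlt⟩
      · exact Or.inl h
      · refine Or.inr (mem_iUnion₂.2 ⟨y, hy, ⟨θ, hθ, hzy.symm⟩, hlt.trans ?_⟩)
        rwa [mem_ball, dist_comm, dist_eq_norm] at hzr
    have hx : (μH[1] : Measure R2) {x} = 0 :=
      (Measure.nullSingletonClass_hausdorff R2 one_pos).measure_singleton x
    refine (measure_mono hsub).trans ((measure_union_le _ _).trans ?_)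
    rw [hx, zero_add]
    refine (measure_biUnion_finset_le _ _).trans (Finset.sum_le_sum fun y _ => ?_)
    by_cases hr : ‖x - y‖ / 2 < r
    · rw [indicator_of_mem (by exact hr)]
      exact measure_mono fun z hz => hz.1
    · simp [hr]
  calc _ ≤ ∫⁻ r in Ioi (0 : ℝ), ∑ y ∈ Y, (Ioi (‖x - y‖ / 2)).indicator
          (fun r => μH[1] (P y) * (ENNReal.ofReal (r ^ 2))⁻¹) r := by
        refine lintegral_mono fun r => ?_
        rw [div_eq_mul_inv]
        refine (mul_le_mul' (hcone r) le_rfl).trans ?_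
        rw [Finset.sum_mul]
        refine Finset.sum_le_sum fun y _ => ?_
        by_cases hr : r ∈ Ioi (‖x - y‖ / 2) <;> simp [hr]
    _ ≤ ∑ y ∈ Y, μH[1] (P y) * ENNReal.ofReal (‖x - y‖ / 2)⁻¹ := by
        rw [lintegral_finsetSum _ fun y _ => Measurable.indicator (by fun_prop) measurableSet_Ioi]
        refine Finset.sum_le_sum fun y hy => ?_
        have hpos : 0 < ‖x - y‖ := norm_pos_iff.2 (sub_ne_zero.2 (hY y hy).2.symm)
        refine (setLIntegral_le_lintegral _ _).trans ?_
        rw [lintegral_indicator measurableSet_Ioi, lintegral_const_mul _ (by fun_prop),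
          lintegral_Ioi_inv_sq (by positivity)]
    _ ≤ ∑ y ∈ Y, ENNReal.ofReal (16 * Real.pi * (b - a)) / ENNReal.ofReal |proj θ₀ d| := by
        refine Finset.sum_le_sum fun y hy => ?_
        have hpos : 0 < ‖x - y‖ := norm_pos_iff.2 (sub_ne_zero.2 (hY y hy).2.symm)
        refine (mul_le_mul' (hPm y hy) le_rfl).trans (le_of_eq ?_)
        have := Real.pi_pos
        have := sub_nonneg.2 hab
        rw [← ENNReal.ofReal_mul (by positivity), ← ENNReal.ofReal_div_of_pos hc]
        congr 1
        field_simp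
        ring
    _ = _ := by
        rw [Finset.sum_const, nsmul_eq_mul, div_eq_mul_inv, div_eq_mul_inv]
        ring

lemma exists_smul_of_mem_segment {p q d z : R2} {t : ℝ} (h : q - p = t • d)
    (hz : z ∈ segment ℝ p q) : ∃ s : ℝ, z = p + s • d := by
  rw [segment_eq_image'] at hz
  obtain ⟨s, -, rfl⟩ := hz
  exact ⟨s * t, by simp only [h, smul_smul]⟩

lemma exists_pos_add_smul_mem_segment {p q d y : R2} {t : ℝ} (h : q - p = t • d)
    (hy : y ∈ segment ℝ p q) (hp : p ≠ y) (hq : q ≠ y) :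
    ∃ ε > 0, ∀ s : ℝ, |s| < ε → y + s • d ∈ segment ℝ p q := by
  obtain ⟨a, b, ha, hb, hab, rfl⟩ := mem_openSegment_of_ne_left_right hp hq hy
  have ht : t ≠ 0 := by
    rintro rfl
    rw [zero_smul, sub_eq_zero] at h
    rw [h, ← add_smul, hab, one_smul] at hp
    exact hp rfl
  refine ⟨|t| * min a b, by positivity, fun s hs => ?_⟩
  have h1 : |s / t| < min a b := by
    rw [abs_div, div_lt_iff₀ (abs_pos.2 ht)]; linarith
  obtain ⟨h2, h3⟩ := abs_lt.1 h1
  have h4 := min_le_left a b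
  have h5 := min_le_right a b
  refine ⟨a - s / t, b + s / t, by linarith, by linarith, by linarith, ?_⟩
  have hd : s • d = (s / t) • (q - p) := by rw [h, smul_smul, div_mul_cancel₀ _ ht]
  rw [hd]
  module

/-- Away from finitely many exceptional directions, the conical energy over a small interval of
directions `I` near `θ₀` is at most a multiple of `|I|` times the maximal function at `θ₀`. -/
lemma exists_lintegral_coneT_le {n : ℕ} {d : R2} {p q : Fin n → R2} {t : Fin n → ℝ} {E : Set R2}
    (hE : E = ⋃ i, segment ℝ (p i) (q i)) (hd : ‖d‖ = 1) (ht : ∀ i, q i - p i = t i • d)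
    {x : R2} {θ₀ : ℝ} (hθ₀ : proj θ₀ d ≠ 0) (hp : ∀ i, p i ≠ x → proj θ₀ (p i) ≠ proj θ₀ x)
    (hq : ∀ i, q i ≠ x → proj θ₀ (q i) ≠ proj θ₀ x) :
    ∃ δ > 0, ∀ a b : ℝ, a ≤ b → Ico a b ⊆ ball θ₀ δ →
      ∫⁻ r in Ioi (0 : ℝ), (μH[1].restrict E) (coneT x ((fun θ => θ + 1 / 4) '' Ico a b) r)
        / ENNReal.ofReal (r ^ 2) ≤
      ENNReal.ofReal (16 * Real.pi * (b - a)) * projMax (μH[1].restrict E) θ₀ x := by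
  classical
  have hEc : IsCompact E := hE ▸ isCompact_iUnion fun i => isCompact_segment_R2 _ _
  set y : Fin n → R2 := fun i => p i + crossing d x (p i) θ₀ • d with hydef
  have hy : ∀ i, proj θ₀ (y i) = proj θ₀ x := fun i => by
    rw [hydef, proj_add, proj_smul, crossing, div_mul_cancel₀ _ hθ₀, proj_sub]; ring
  have hyz : ∀ i, ∀ z ∈ segment ℝ (p i) (q i), ∃ s : ℝ, z = y i + s • d := fun i z hz => by
    obtain ⟨s, rfl⟩ := exists_smul_of_mem_segment (ht i) hz
    exact ⟨s - crossing d x (p i) θ₀, by simp only [hydef]; module⟩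
  set Y : Finset R2 :=
    (Finset.univ.filter fun i => y i ∈ segment ℝ (p i) (q i) ∧ y i ≠ x).image y with hYdef
  have hY : ∀ z ∈ Y, ∃ i, y i = z ∧ z ∈ segment ℝ (p i) (q i) ∧ z ≠ x := fun z hz => by
    simp only [hYdef, Finset.mem_image, Finset.mem_filter, Finset.mem_univ, true_and] at hz
    obtain ⟨i, h, rfl⟩ := hz
    exact ⟨i, rfl, h⟩
  have hYx : ∀ z ∈ Y, proj θ₀ z = proj θ₀ x ∧ z ≠ x := fun z hz => by
    obtain ⟨i, rfl, -, h⟩ := hY z hz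
    exact ⟨hy i, h⟩
  have hcard : (Y.card : ℝ≥0∞) / ENNReal.ofReal |proj θ₀ d| ≤ projMax (μH[1].restrict E) θ₀ x := by
    have h1 : ∀ z ∈ Y, ∃ ε > 0, ∀ s : ℝ, |s| < ε → z + s • d ∈ E := by
      intro z hz
      obtain ⟨i, hi, hzs, hzx⟩ := hY z hz
      obtain ⟨ε, hε, h⟩ := exists_pos_add_smul_mem_segment (ht i) hzs
        (fun h => hp i (h ▸ hzx) (h ▸ (hYx z hz).1)) (fun h => hq i (h ▸ hzx) (h ▸ (hYx z hz).1))
      exact ⟨ε, hε, fun s hs => hE ▸ mem_iUnion.2 ⟨i, h s hs⟩⟩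
    have h2 : ∀ᶠ ε in 𝓝[>] (0 : ℝ), ∀ z ∈ Y, ∀ s : ℝ, |s| < ε → z + s • d ∈ E := by
      rw [Filter.eventually_all_finset]
      intro z hz
      obtain ⟨ε, hε, h⟩ := h1 z hz
      filter_upwards [Ioo_mem_nhdsGT hε] with ε' hε' s hs
      exact h s (hs.trans hε'.2)
    obtain ⟨ε, h3, hε⟩ := (h2.and self_mem_nhdsWithin).exists
    exact card_div_le_projMax Y hε hd hθ₀ hEc.measurableSet (fun z hz => (hYx z hz).1) h3
  have hnear : ∀ᶠ θ in 𝓝 θ₀, |proj θ₀ d| / 2 ≤ |proj θ d| ∧ ∀ i, ∀ z ∈ segment ℝ (p i) (q i),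
      proj θ z = proj θ x → z = x ∨
        ∃ y ∈ Y, z = y + crossing d x y θ • d ∧ ‖x - y‖ / 2 < ‖x - z‖ := by
    have hhalf : ∀ᶠ θ in 𝓝 θ₀, |proj θ₀ d| / 2 < |proj θ d| :=
      (continuous_proj_left d).abs.continuousAt.eventually_const_lt
        (half_lt_self (abs_pos.2 hθ₀))
    have hhalf' : ∀ᶠ θ in 𝓝 θ₀, proj θ d ≠ 0 := hhalf.mono fun θ h =>
      abs_pos.1 ((half_pos (abs_pos.2 hθ₀)).trans h)
    refine (hhalf.mono fun _ => le_of_lt).and (eventually_all.2 fun i => ?_)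
    have hw0 : y i + crossing d x (y i) θ₀ • d = y i := by
      rw [crossing, proj_sub, hy i, sub_self, zero_div, zero_smul, add_zero]
    have hw : Tendsto (fun θ => y i + crossing d x (y i) θ • d) (𝓝 θ₀) (𝓝 (y i)) := by
      conv => arg 3; rw [← hw0]
      exact tendsto_const_nhds.add ((continuousAt_crossing hθ₀).tendsto.smul_const d)
    by_cases hmem : y i ∈ segment ℝ (p i) (q i)
    · by_cases hyx : y i = x
      · filter_upwards [hhalf'] with θ hθ z hz hzθ
        obtain ⟨s, rfl⟩ := hyz i z hz
        left
        rw [eq_crossing hθ hzθ, hyx, crossing, sub_self, ← zero_smul ℝ (0 : R2), proj_smul, zero_mul,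
          zero_div, zero_smul, add_zero]
      · have hlt : ∀ᶠ θ in 𝓝 θ₀,
            ‖x - y i‖ / 2 < ‖x - (y i + crossing d x (y i) θ • d)‖ :=
          (tendsto_const_nhds.sub hw).norm.eventually_const_lt
            (half_lt_self (norm_pos_iff.2 (sub_ne_zero.2 (Ne.symm hyx))))
        filter_upwards [hhalf', hlt] with θ hθ hltθ z hz hzθ
        obtain ⟨s, rfl⟩ := hyz i z hz
        rw [eq_crossing hθ hzθ]
        exact Or.inr ⟨y i, Finset.mem_image_of_mem y (by simp [hmem, hyx]), rfl, hltθ⟩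
    · filter_upwards [hhalf', hw ((isCompact_segment_R2 (p i) (q i)).isClosed.isOpen_compl.mem_nhds
        hmem)] with θ hθ hnot z hz hzθ
      obtain ⟨s, rfl⟩ := hyz i z hz
      rw [eq_crossing hθ hzθ] at hz
      exact absurd hz hnot
  obtain ⟨δ, hδ, hball⟩ := Metric.eventually_nhds_iff_ball.1 hnear
  refine ⟨δ, hδ, fun a b hab hI => ?_⟩
  refine (lintegral_coneT_le Y hd hθ₀ hab hEc.measurableSet hYx
    (fun θ hθ => (hball θ (hI hθ)).1) fun θ hθ z hz hzθ => ?_).trans (mul_le_mul' le_rfl hcard)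
  rw [hE, mem_iUnion] at hz
  obtain ⟨i, hi⟩ := hz
  exact (hball θ (hI hθ)).2 i z hi hzθ

/-! ### Families of triadic intervals -/

/-- The `k`-th triadic interval of generation `j`. -/
def triadicIco (j k : ℕ) : Set ℝ := Ico ((k : ℝ) / 3 ^ j) ((k + 1 : ℝ) / 3 ^ j)

lemma mem_triadicIco {j k : ℕ} {θ : ℝ} :
    θ ∈ triadicIco j k ↔ 0 ≤ θ ∧ ⌊θ * 3 ^ j⌋₊ = k := by
  have h3 : (0 : ℝ) < 3 ^ j := by positivity
  rw [triadicIco, mem_Ico, div_le_iff₀ h3, lt_div_iff₀ h3]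
  constructor
  · rintro ⟨h1, h2⟩
    have h0 : 0 ≤ θ * 3 ^ j := (Nat.cast_nonneg k).trans h1
    exact ⟨nonneg_of_mul_nonneg_left h0 h3, (Nat.floor_eq_iff h0).2 ⟨h1, h2⟩⟩
  · rintro ⟨h0, h⟩
    exact (Nat.floor_eq_iff (by positivity)).1 h

lemma triadicIco_subset {j j₀ k k₀ : ℕ} {θ : ℝ} (hj : j₀ ≤ j) (h : θ ∈ triadicIco j k)
    (h₀ : θ ∈ triadicIco j₀ k₀) : triadicIco j k ⊆ triadicIco j₀ k₀ := by
  have key : ∀ θ : ℝ, ⌊θ * 3 ^ j₀⌋₊ = ⌊θ * 3 ^ j⌋₊ / 3 ^ (j - j₀) := by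
    intro θ
    rw [← Nat.floor_div_natCast]
    congr 1
    obtain ⟨m, rfl⟩ := Nat.exists_eq_add_of_le hj
    rw [Nat.add_sub_cancel_left, pow_add]
    push_cast
    field_simp
  intro θ' hθ'
  rw [mem_triadicIco] at *
  refine ⟨hθ'.1, ?_⟩
  rw [key, hθ'.2, ← h.2, ← key, h₀.2]

lemma triadicIco_subset_ball {j k : ℕ} {θ δ : ℝ} (hδ : 1 / 3 ^ j < δ) (h : θ ∈ triadicIco j k) :
    triadicIco j k ⊆ ball θ δ := by
  intro θ' hθ'
  rw [triadicIco, mem_Ico, add_div] at *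
  rw [mem_ball, Real.dist_eq, abs_lt]
  constructor <;> linarith [h.1, h.2, hθ'.1, hθ'.2]

/-- If a property of intervals holds for all small enough intervals around each point of `S`, then
a large part of `S` is covered by finitely many disjoint triadic intervals with this property. -/
lemma exists_triadic_family {J₀ S : Set ℝ} (hJ : IsTriadic J₀) (hS : S ⊆ J₀) {P : Set ℝ → Prop}
    (hP : ∀ θ ∈ S, ∃ δ > 0, ∀ a b : ℝ, a ≤ b → θ ∈ Ico a b → Ico a b ⊆ ball θ δ → P (Ico a b))
    {c : ℝ≥0∞} (hc : c < volume S) :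
    ∃ 𝒢 : Finset (Set ℝ), (∀ I ∈ 𝒢, IsTriadic I ∧ I ⊆ J₀ ∧ P I) ∧
      (𝒢 : Set (Set ℝ)).Pairwise Disjoint ∧ c ≤ volume (⋃₀ (𝒢 : Set (Set ℝ))) := by
  classical
  obtain ⟨j₀, k₀, hk₀, rfl⟩ := hJ
  change S ⊆ triadicIco j₀ k₀ at hS
  change ∃ 𝒢 : Finset (Set ℝ), (∀ I ∈ 𝒢, IsTriadic I ∧ I ⊆ triadicIco j₀ k₀ ∧ P I) ∧ _
  have hmem : ∀ θ ∈ S, ∀ j, θ ∈ triadicIco j ⌊θ * 3 ^ j⌋₊ := fun θ hθ j =>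
    mem_triadicIco.2 ⟨(mem_triadicIco.1 (hS hθ)).1, rfl⟩
  set A : ℕ → Set ℝ := fun j => {θ ∈ S | ∀ i ≥ j,
    triadicIco i ⌊θ * 3 ^ i⌋₊ ⊆ triadicIco j₀ k₀ ∧ P (triadicIco i ⌊θ * 3 ^ i⌋₊)}
  have hAmono : Monotone A := fun i j hij θ hθ => ⟨hθ.1, fun k hk => hθ.2 k (hij.trans hk)⟩
  have hA : S ⊆ ⋃ j, A j := by
    intro θ hθ
    obtain ⟨δ, hδ, h⟩ := hP θ hθ
    obtain ⟨m, hm⟩ := exists_pow_lt_of_lt_one hδ (show (1 / 3 : ℝ) < 1 by norm_num)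
    refine mem_iUnion.2 ⟨max j₀ m, hθ, fun i hi => ?_⟩
    refine ⟨triadicIco_subset (le_of_max_le_left hi) (hmem θ hθ i) (hS hθ), ?_⟩
    refine h _ _ (by gcongr; linarith) (hmem θ hθ i) (triadicIco_subset_ball ?_ (hmem θ hθ i))
    refine lt_of_le_of_lt ?_ hm
    rw [← one_div_pow]
    exact pow_le_pow_of_le_one (by norm_num) (by norm_num) (le_of_max_le_right hi)
  have hlt : c < ⨆ j, volume (A j) := by
    rw [← hAmono.measure_iUnion]
    exact hc.trans_le (measure_mono hA)
  obtain ⟨j, hj⟩ := lt_iSup_iff.1 hlt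
  refine ⟨((Finset.range (3 ^ j)).filter fun k => ∃ θ ∈ A j, ⌊θ * 3 ^ j⌋₊ = k).image
    (triadicIco j), ?_, ?_, ?_⟩
  · intro I hI
    simp only [Finset.mem_image, Finset.mem_filter, Finset.mem_range] at hI
    obtain ⟨k, ⟨hk, θ, hθ, rfl⟩, rfl⟩ := hI
    exact ⟨⟨j, _, hk, rfl⟩, hθ.2 j le_rfl⟩
  · intro I hI I' hI' hne
    simp only [Finset.coe_image, mem_image] at hI hI'
    obtain ⟨k, -, rfl⟩ := hI
    obtain ⟨k', -, rfl⟩ := hI'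
    refine Set.disjoint_left.2 fun θ h h' => hne ?_
    rw [← (mem_triadicIco.1 h).2, ← (mem_triadicIco.1 h').2]
  · refine hj.le.trans (measure_mono fun θ hθ => ?_)
    refine ⟨_, ?_, hmem θ hθ.1 j⟩
    refine Finset.mem_coe.2 (Finset.mem_image_of_mem _ (Finset.mem_filter.2 ⟨?_, θ, hθ, rfl⟩))
    have h1 : θ < 1 := by
      refine (hS hθ.1).2.trans_le ?_
      rw [div_le_one (by positivity)]
      exact_mod_cast hk₀
    rw [Finset.mem_range, Nat.floor_lt' (by positivity)]
    push_cast
    nlinarith [show (0 : ℝ) < 3 ^ j by positivity]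

/-! ### The set of points with many good directions -/

lemma FinUnionParallelSegments.isCompact {E : Set R2} (hE : FinUnionParallelSegments E) :
    IsCompact E := by
  obtain ⟨n, d, p, q, -, -, rfl⟩ := hE
  exact isCompact_iUnion fun i => isCompact_segment_R2 _ _

lemma FinUnionParallelSegments.hausdorffMeasure_lt_top {E : Set R2}
    (hE : FinUnionParallelSegments E) : μH[1] E < ∞ := by
  obtain ⟨n, d, p, q, -, -, rfl⟩ := hE
  refine (measure_iUnion_le _).trans_lt ?_
  simp only [hausdorffMeasure_segment, tsum_fintype]
  exact ENNReal.sum_lt_top.2 fun i _ => edist_lt_top _ _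

/-- The lower bound on `π_θ(E)` and the weak type inequality give many points of `E` at which
the maximal function in direction `θ` is small. -/
lemma le_measure_goodPairs {E : Set R2} {κ θ : ℝ} (hκ : 0 < κ) (hE : MeasurableSet E)
    (hfin : μH[1] E < ∞) (hθ : ENNReal.ofReal κ * μH[1] E < μH[1] (proj θ '' E)) :
    ENNReal.ofReal (κ / 2) * μH[1] E ≤
      (μH[1].restrict E) (Prod.mk θ ⁻¹' goodPairs (μH[1].restrict E) (10 / κ)) := by
  set μ : Measure R2 := μH[1].restrict E with hμ
  have : IsFiniteMeasure μ := ⟨by rwa [hμ, Measure.restrict_apply_univ]⟩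
  set T : Set R2 := Prod.mk θ ⁻¹' goodPairs μ (10 / κ)
  have hbad : μH[1] {t | ENNReal.ofReal (10 / κ) < maximalFn (μ.map (proj θ)) t} ≤
      ENNReal.ofReal (κ / 2) * μH[1] E := by
    rw [hausdorffMeasure_real]
    refine (volume_lt_maximalFn_le _ (by positivity)).trans (le_of_eq ?_)
    have h5 : ENNReal.ofReal (κ / 2) = 5 * ENNReal.ofReal (κ / 10) := by
      rw [← ENNReal.ofReal_ofNat 5, ← ENNReal.ofReal_mul (by norm_num)]
      congr 1
      ring
    rw [Measure.map_apply (continuous_proj θ).measurable MeasurableSet.univ, preimage_univ, hμ,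
      Measure.restrict_apply_univ, div_eq_mul_inv, ← ENNReal.ofReal_inv_of_pos (by positivity),
      inv_div, h5, mul_right_comm]
  have hsub : proj θ '' E ⊆ proj θ '' (T ∩ E) ∪
      {t | ENNReal.ofReal (10 / κ) < maximalFn (μ.map (proj θ)) t} := by
    rintro _ ⟨x, hx, rfl⟩
    by_cases h : (θ, x) ∈ goodPairs μ (10 / κ)
    · exact Or.inl ⟨x, ⟨h, hx⟩, rfl⟩
    · have h' := lt_projMax_of_notMem_goodPairs h
      exact Or.inr h'
  have hproj : μH[1] (proj θ '' (T ∩ E)) ≤ μ T := by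
    rw [hμ, Measure.restrict_apply' hE]
    simpa using (lipschitzWith_proj θ).hausdorffMeasure_image_le zero_le_one (T ∩ E)
  have hsum : ENNReal.ofReal (κ / 2) * μH[1] E + ENNReal.ofReal (κ / 2) * μH[1] E ≤
      μ T + ENNReal.ofReal (κ / 2) * μH[1] E := by
    rw [← add_mul, ← ENNReal.ofReal_add (by positivity) (by positivity), add_halves]
    exact hθ.le.trans ((measure_mono hsub).trans
      ((measure_union_le _ _).trans (add_le_add hproj hbad)))
  exact (ENNReal.add_le_add_iff_right
    (ENNReal.mul_ne_top ENNReal.ofReal_ne_top hfin.ne)).1 hsum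

/-- A Fubini argument: if all sections `{x | (θ, x) ∈ A}` have mass at least `2 * c * μ univ`, then
the set of `x` for which `{θ | (θ, x) ∈ A}` has mass at least `c * ν univ` has mass at
least `c * μ univ`. -/
lemma le_measure_of_forall_section {α β : Type*} [MeasurableSpace α] [MeasurableSpace β]
    {ν : Measure α} {μ : Measure β} [IsFiniteMeasure ν] [IsFiniteMeasure μ] {A : Set (α × β)}
    (hA : MeasurableSet A) {c : ℝ≥0∞} (hc : c ≠ ∞) (hν : ν univ ≠ 0)
    (h : ∀ᵐ θ ∂ν, (c + c) * μ univ ≤ μ (Prod.mk θ ⁻¹' A)) :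
    c * μ univ ≤ μ {x | c * ν univ ≤ ν ((fun θ => (θ, x)) ⁻¹' A)} := by
  set B : Set β := {x | c * ν univ ≤ ν ((fun θ => (θ, x)) ⁻¹' A)}
  have hB : MeasurableSet B := measurableSet_le measurable_const (measurable_measure_prodMk_right hA)
  have h1 : (c + c) * μ univ * ν univ ≤ (ν.prod μ) A := by
    rw [Measure.prod_apply hA, ← lintegral_const]
    exact lintegral_mono_ae h
  have h2 : (ν.prod μ) A ≤ ν univ * μ B + c * ν univ * μ univ := by
    rw [Measure.prod_apply_symm hA]
    calc _ ≤ ∫⁻ x, B.indicator (fun _ => ν univ) x + c * ν univ ∂μ := by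
          refine lintegral_mono fun x => ?_
          by_cases hx : x ∈ B
          · rw [indicator_of_mem hx]
            exact (measure_mono (subset_univ _)).trans le_self_add
          · rw [indicator_of_notMem hx, zero_add]
            exact (not_le.1 hx).le
      _ = _ := by
          rw [lintegral_add_right _ measurable_const, lintegral_const,
            lintegral_indicator_const hB]
  have h3 : c * μ univ * ν univ + c * μ univ * ν univ ≤ μ B * ν univ + c * μ univ * ν univ := by
    calc _ = (c + c) * μ univ * ν univ := by ring
      _ ≤ _ := h1.trans h2
      _ = _ := by ring
  have h4 : c * μ univ * ν univ ≠ ∞ :=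
    ENNReal.mul_ne_top (ENNReal.mul_ne_top hc (measure_ne_top _ _)) (measure_ne_top _ _)
  have h5 := (ENNReal.add_le_add_iff_right h4).1 h3
  exact (ENNReal.mul_le_mul_iff_left hν (measure_ne_top _ _)).1 h5

lemma measurable_measure_coneT (μ : Measure R2) (x : R2) (S : Set ℝ) :
    Measurable fun r => μ (coneT x S r) :=
  Monotone.measurable fun _ _ h => measure_mono (inter_subset_inter_right _ (ball_subset_ball h))

lemma coneT_iUnion_subset (x : R2) (𝒢 : Finset (Set ℝ)) (r : ℝ) :
    coneT x ((fun θ => θ + 1 / 4) '' ⋃₀ (𝒢 : Set (Set ℝ))) r ⊆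
      ⋃ I ∈ 𝒢, coneT x ((fun θ => θ + 1 / 4) '' I) r := by
  rintro z ⟨hz, hzr⟩
  simp only [cone, mem_iUnion, exists_prop] at hz
  obtain ⟨_, ⟨θ, ⟨I, hI, hθ⟩, rfl⟩, h⟩ := hz
  refine mem_iUnion₂.2 ⟨I, hI, mem_iUnion₂.2 ⟨_, ⟨θ, hθ, rfl⟩, h⟩, hzr⟩

/-- Conical energy is subadditive in the set of directions. -/
lemma lintegral_coneT_sUnion_le (μ : Measure R2) (x : R2) (𝒢 : Finset (Set ℝ)) :
    ∫⁻ r in Ioi (0 : ℝ), μ (coneT x ((fun θ => θ + 1 / 4) '' ⋃₀ (𝒢 : Set (Set ℝ))) r)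
        / ENNReal.ofReal (r ^ 2) ≤
      ∑ I ∈ 𝒢, ∫⁻ r in Ioi (0 : ℝ), μ (coneT x ((fun θ => θ + 1 / 4) '' I) r)
        / ENNReal.ofReal (r ^ 2) := by
  have hm : ∀ I ∈ 𝒢, Measurable fun r =>
      μ (coneT x ((fun θ => θ + 1 / 4) '' I) r) / ENNReal.ofReal (r ^ 2) := fun I _ =>
    (measurable_measure_coneT μ x _).div (by fun_prop)
  rw [← lintegral_finsetSum _ hm]
  refine lintegral_mono fun r => ?_
  simp only [div_eq_mul_inv]
  rw [← Finset.sum_mul]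
  exact mul_le_mul' ((measure_mono (coneT_iUnion_subset x 𝒢 r)).trans
    (measure_biUnion_finset_le _ _)) le_rfl

lemma IsTriadic.measurableSet {I : Set ℝ} (hI : IsTriadic I) : MeasurableSet I := by
  obtain ⟨j, k, -, rfl⟩ := hI
  exact measurableSet_Ico

lemma IsTriadic.volume_lt_top {I : Set ℝ} (hI : IsTriadic I) : volume I < ∞ := by
  obtain ⟨j, k, -, rfl⟩ := hI
  exact measure_Ico_lt_top

/-- For almost every direction `θ₀`, the conical energy over small intervals around `θ₀` is
controlled by the maximal function. -/
lemma FinUnionParallelSegments.ae_lintegral_coneT_le {E : Set R2} (hE : FinUnionParallelSegments E)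
    (x : R2) : ∀ᵐ θ₀ : ℝ, ∃ δ > 0, ∀ a b : ℝ, a ≤ b → Ico a b ⊆ ball θ₀ δ →
      ∫⁻ r in Ioi (0 : ℝ), (μH[1].restrict E) (coneT x ((fun θ => θ + 1 / 4) '' Ico a b) r)
        / ENNReal.ofReal (r ^ 2) ≤
      ENNReal.ofReal (16 * Real.pi * (b - a)) * projMax (μH[1].restrict E) θ₀ x := by
  obtain ⟨n, d, p, q, hd, ht, hE⟩ := hE
  choose t ht using ht
  have hd0 : ‖d‖ ≠ 0 := norm_ne_zero_iff.2 hd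
  have hnull : ∀ {w : R2}, w ≠ 0 → ∀ᵐ θ : ℝ, proj θ w ≠ 0 := fun {w} hw => by
    rw [ae_iff]
    simpa using volume_proj_eq_zero hw
  have hpt : ∀ w : R2, ∀ᵐ θ : ℝ, w ≠ x → proj θ w ≠ proj θ x := fun w => by
    by_cases hw : w = x
    · simp [hw]
    · filter_upwards [hnull (sub_ne_zero.2 hw)] with θ hθ _ h
      exact hθ (by rw [proj_sub, h, sub_self])
  filter_upwards [hnull hd, ae_all_iff.2 fun i => hpt (p i), ae_all_iff.2 fun i => hpt (q i)]
    with θ hθd hθp hθq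
  refine exists_lintegral_coneT_le (d := ‖d‖⁻¹ • d) (t := fun i => t i * ‖d‖) hE ?_ ?_ ?_ hθp hθq
  · rw [norm_smul, norm_inv, norm_norm, inv_mul_cancel₀ hd0]
  · intro i
    rw [ht, smul_smul, mul_assoc, mul_inv_cancel₀ hd0, mul_one]
  · rw [proj_smul]
    exact mul_ne_zero (inv_ne_zero hd0) hθd

/-- base lemma for the iteration, for finite unions of parallel segments. -/
theorem statement7 :
    ∃ C : ℝ, 1 ≤ C ∧
      ∀ (κ : ℝ) (J₀ G : Set ℝ) (E : Set R2), 0 < κ →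
        IsTriadic J₀ → MeasurableSet G → G ⊆ J₀ → 0 < μH[1] G →
        FinUnionParallelSegments E →
        (∀ θ ∈ G, ENNReal.ofReal κ * μH[1] E < μH[1] (proj θ '' E)) →
        ∃ E' : Set R2, MeasurableSet E' ∧ E' ⊆ E ∧
          ENNReal.ofReal (κ/4) * μH[1] E ≤ μH[1] E' ∧
          ∀ x ∈ E', ∃ 𝒢 : Finset (Set ℝ),
            (∀ I ∈ 𝒢, IsTriadic I ∧ I ⊆ J₀) ∧
            ((𝒢 : Set (Set ℝ)).Pairwise Disjoint) ∧
            ENNReal.ofReal (κ/5) * μH[1] G ≤ μH[1] (⋃₀ (𝒢 : Set (Set ℝ))) ∧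
            (∀ I ∈ 𝒢, ∃ θI ∈ I,
              projMax (μH[1].restrict E) θI x ≤ ENNReal.ofReal (C * κ⁻¹)) ∧
            (∫⁻ r in Set.Ioi (0:ℝ),
                (μH[1].restrict E)
                  (coneT x ((fun θ => θ + 1/4) '' ⋃₀ (𝒢 : Set (Set ℝ))) r)
                  / ENNReal.ofReal (r^2)) ≤
              ENNReal.ofReal (C * (C * κ⁻¹)) * μH[1] G := by
  refine ⟨100, by norm_num, ?_⟩
  intro κ J₀ G E hκ hJ hGm hGJ hG0 hE hproj
  have hvolG : (μH[1] : Measure ℝ) = volume := hausdorffMeasure_real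
  simp only [hvolG] at hG0 ⊢
  have hEm : MeasurableSet E := hE.isCompact.measurableSet
  have hGtop : volume G ≠ ∞ := ((measure_mono hGJ).trans_lt hJ.volume_lt_top).ne
  set μ : Measure R2 := μH[1].restrict E with hμ
  have hμu : μ univ = μH[1] E := Measure.restrict_apply_univ E
  have : IsFiniteMeasure μ := ⟨hμu ▸ hE.hausdorffMeasure_lt_top⟩
  have : IsFiniteMeasure (volume.restrict G) :=
    ⟨by rw [Measure.restrict_apply_univ]; exact hGtop.lt_top⟩
  have hA := measurableSet_goodPairs μ (10 / κ)
  set A := goodPairs μ (10 / κ) with hAdef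
  set B : Set R2 := {x | ENNReal.ofReal (κ / 4) * (volume.restrict G) univ ≤
    (volume.restrict G) ((fun θ => (θ, x)) ⁻¹' A)} with hBdef
  have hB : MeasurableSet B :=
    measurableSet_le measurable_const (measurable_measure_prodMk_right hA)
  refine ⟨B ∩ E, hB.inter hEm, inter_subset_right, ?_, ?_⟩
  · rw [← Measure.restrict_apply' hEm, ← hμ, ← hμu]
    refine le_measure_of_forall_section hA ENNReal.ofReal_ne_top
      (by rw [Measure.restrict_apply_univ]; exact hG0.ne') ?_
    refine (ae_restrict_iff' hGm).2 (Eventually.of_forall fun θ hθ => ?_)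
    rw [hμu, ← ENNReal.ofReal_add (by positivity) (by positivity),
      show κ / 4 + κ / 4 = κ / 2 by ring]
    exact le_measure_goodPairs hκ hEm hE.hausdorffMeasure_lt_top (hproj θ hθ)
  rintro x ⟨hxB, -⟩
  obtain ⟨U, hGU, hUo, hU⟩ : ∃ U ⊇ G, IsOpen U ∧ volume U < 2 * volume G := by
    refine exists_isOpen_lt_of_lt G _ ?_
    rw [two_mul]
    exact ENNReal.lt_add_right hGtop hG0.ne'
  set D : Set ℝ := {θ₀ | ∃ δ > 0, ∀ a b : ℝ, a ≤ b → Ico a b ⊆ ball θ₀ δ →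
      ∫⁻ r in Ioi (0 : ℝ), μ (coneT x ((fun θ => θ + 1 / 4) '' Ico a b) r)
        / ENNReal.ofReal (r ^ 2) ≤
      ENNReal.ofReal (16 * Real.pi * (b - a)) * projMax μ θ₀ x}
  have hD : ∀ᵐ θ : ℝ, θ ∈ D := hE.ae_lintegral_coneT_le x
  set S : Set ℝ := ((fun θ => (θ, x)) ⁻¹' A ∩ G) ∩ D
  have hSmax : ∀ θ ∈ S, projMax μ θ x ≤ ENNReal.ofReal (20 / κ) := fun θ hθ => by
    have := projMax_le_of_mem_goodPairs hθ.1.1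
    rwa [show 2 * (10 / κ) = 20 / κ by ring] at this
  have hSvol : ENNReal.ofReal (κ / 5) * volume G < volume S := by
    have h1 : volume S = volume ((fun θ => (θ, x)) ⁻¹' A ∩ G) :=
      measure_inter_conull (by simpa [mem_ae_iff] using hD)
    have h2 : ENNReal.ofReal (κ / 4) * volume G ≤ volume ((fun θ => (θ, x)) ⁻¹' A ∩ G) := by
      rwa [hBdef, mem_ofPred_eq, Measure.restrict_apply_univ, Measure.restrict_apply' hGm] at hxB
    rw [h1]
    refine lt_of_lt_of_le ?_ h2
    refine (ENNReal.mul_lt_mul_iff_left hG0.ne' hGtop).2 ?_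
    exact (ENNReal.ofReal_lt_ofReal_iff (by positivity)).2 (by linarith)
  obtain ⟨𝒢, h𝒢, hdisj, hvol⟩ := exists_triadic_family hJ
    (fun θ hθ => hGJ hθ.1.2 : S ⊆ J₀)
    (P := fun I => I ⊆ U ∧ (∃ θ ∈ I, projMax μ θ x ≤ ENNReal.ofReal (20 / κ)) ∧
      ∫⁻ r in Ioi (0 : ℝ), μ (coneT x ((fun θ => θ + 1 / 4) '' I) r) / ENNReal.ofReal (r ^ 2) ≤
        ENNReal.ofReal (16 * Real.pi * (20 / κ)) * volume I)
    (fun θ hθ => by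
      obtain ⟨δ, hδ, h⟩ := hθ.2
      obtain ⟨δ', hδ', h'⟩ := Metric.isOpen_iff.1 hUo θ (hGU hθ.1.2)
      refine ⟨min δ δ', lt_min hδ hδ', fun a b hab hmem hsub => ?_⟩
      refine ⟨hsub.trans ((ball_subset_ball (min_le_right _ _)).trans h'),
        ⟨θ, hmem, hSmax θ hθ⟩, ?_⟩
      refine (h a b hab (hsub.trans (ball_subset_ball (min_le_left _ _)))).trans ?_
      refine (mul_le_mul' le_rfl (hSmax θ hθ)).trans (le_of_eq ?_)
      have := Real.pi_pos
      have := sub_nonneg.2 hab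
      rw [Real.volume_Ico, ← ENNReal.ofReal_mul (by positivity),
        ← ENNReal.ofReal_mul (by positivity)]
      congr 1
      ring) hSvol
  refine ⟨𝒢, fun I hI => ⟨(h𝒢 I hI).1, (h𝒢 I hI).2.1⟩, hdisj, hvol, fun I hI => ?_, ?_⟩
  · obtain ⟨θ, hθ, h⟩ := (h𝒢 I hI).2.2.2.1
    refine ⟨θ, hθ, h.trans (ENNReal.ofReal_le_ofReal ?_)⟩
    rw [div_eq_mul_inv]
    gcongr
    norm_num
  · calc _ ≤ _ := lintegral_coneT_sUnion_le μ x 𝒢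
      _ ≤ ∑ I ∈ 𝒢, ENNReal.ofReal (16 * Real.pi * (20 / κ)) * volume I :=
          Finset.sum_le_sum fun I hI => (h𝒢 I hI).2.2.2.2
      _ = ENNReal.ofReal (16 * Real.pi * (20 / κ)) * volume (⋃ I ∈ 𝒢, I) := by
          rw [← Finset.mul_sum, measure_biUnion_finset (fun I hI J hJ h => hdisj hI hJ h)
            fun I hI => (h𝒢 I hI).1.measurableSet]
      _ ≤ ENNReal.ofReal (16 * Real.pi * (20 / κ)) * (2 * volume G) := by
          refine mul_le_mul' le_rfl ((measure_mono ?_).trans hU.le)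
          exact iUnion₂_subset fun I hI => (h𝒢 I hI).2.2.1
      _ = ENNReal.ofReal (16 * Real.pi * (20 / κ) * 2) * volume G := by
          rw [← mul_assoc, ENNReal.ofReal_mul (q := 2) (by have := Real.pi_pos; positivity),
            ENNReal.ofReal_ofNat]
      _ ≤ _ := by
          refine mul_le_mul' (ENNReal.ofReal_le_ofReal ?_) le_rfl
          rw [div_eq_mul_inv]
          have h1 := Real.pi_le_four
          have h2 : 0 < κ⁻¹ := inv_pos.2 hκ
          nlinarith

end
end

section
/- There is an absolute constant C such that: let μ be a Radon measure on ℝ², α ≥ 1, x ∈ ℝ², I ⊂ 𝕋 an interval, and suppose that μ_θ^⊥(x) ≤ M for some θ ∈ αI. Then μ(B_I(x,r)) ≤ C·α·M·ℋ¹(I)·r for every r > 0. -/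
open MeasureTheory Metric Set
open scoped ENNReal NNReal

noncomputable section

lemma projPerp_eq (θ : ℝ) (x : R2) :
    projPerp θ x = x 1 * Real.cos (2 * Real.pi * θ) - x 0 * Real.sin (2 * Real.pi * θ) := by
  have h : 2 * Real.pi * (θ + 1/4) = 2 * Real.pi * θ + Real.pi / 2 := by ring
  rw [projPerp, proj, h, Real.cos_add_pi_div_two, Real.sin_add_pi_div_two]
  ring

lemma measurable_projPerp (θ : ℝ) : Measurable (projPerp θ) := by
  unfold projPerp proj
  fun_prop

/-- The perpendicular projections rotate into each other. -/
lemma projPerp_sub_projPerp (θ c : ℝ) (x y : R2) :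
    projPerp θ x - projPerp θ y =
      Real.cos (2 * Real.pi * (θ - c)) * (projPerp c x - projPerp c y) -
        Real.sin (2 * Real.pi * (θ - c)) * (proj c x - proj c y) := by
  have h : 2 * Real.pi * θ = 2 * Real.pi * (θ - c) + 2 * Real.pi * c := by ring
  simp only [projPerp_eq, proj]
  rw [h, Real.cos_add, Real.sin_add]
  ring

lemma abs_projPerp_lt_of_mem_bmet {c ℓ r : ℝ} {x y : R2} (hℓ : 0 < ℓ) (hr : 0 < r)
    (hy : y ∈ bmet c ℓ x r) :
    |projPerp c x - projPerp c y| < ℓ * r ∧ |proj c x - proj c y| < r := by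
  have h : (ℓ^2)⁻¹ * (projPerp c x - projPerp c y)^2 + (proj c x - proj c y)^2 < r^2 :=
    (Real.sqrt_lt' hr).1 hy
  have h' : 0 ≤ (ℓ^2)⁻¹ * (projPerp c x - projPerp c y)^2 := by positivity
  constructor
  · refine abs_lt_of_sq_lt_sq ?_ (by positivity)
    have h2 : (ℓ^2)⁻¹ * (projPerp c x - projPerp c y)^2 < r^2 := by
      nlinarith [sq_nonneg (proj c x - proj c y)]
    rw [inv_mul_lt_iff₀ (by positivity)] at h2
    rwa [mul_pow]
  · exact abs_lt_of_sq_lt_sq (by linarith) hr.le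

/-- A `d_I`-ball is contained in a strip perpendicular to any direction near `I`. -/
lemma bmet_subset_preimage_projPerp {α c ℓ r θ : ℝ} (x : R2) (hα : 1 ≤ α) (hℓ : 0 < ℓ)
    (hr : 0 < r) (hθ : θ ∈ itv c (α * ℓ)) :
    bmet c ℓ x r ⊆ projPerp θ ⁻¹'
      Ioo (projPerp θ x - 5 * α * ℓ * r) (projPerp θ x + 5 * α * ℓ * r) := by
  intro y hy
  obtain ⟨h1, h2⟩ := abs_projPerp_lt_of_mem_bmet hℓ hr hy
  have hd : |θ - c| ≤ α * ℓ / 2 := abs_le.2 ⟨by linarith [hθ.1], by linarith [hθ.2]⟩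
  have hsin : |Real.sin (2 * Real.pi * (θ - c))| ≤ 4 * α * ℓ := by
    calc |Real.sin (2 * Real.pi * (θ - c))| ≤ |2 * Real.pi * (θ - c)| := Real.abs_sin_le_abs
      _ = 2 * Real.pi * |θ - c| := by rw [abs_mul, abs_of_pos Real.two_pi_pos]
      _ ≤ 2 * 4 * (α * ℓ / 2) := by gcongr; exact Real.pi_le_four
      _ = 4 * α * ℓ := by ring
  have hlt : |projPerp θ x - projPerp θ y| < 5 * α * ℓ * r := by
    rw [projPerp_sub_projPerp θ c]
    calc _ ≤ |Real.cos (2 * Real.pi * (θ - c))| * |projPerp c x - projPerp c y| +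
          |Real.sin (2 * Real.pi * (θ - c))| * |proj c x - proj c y| := by
            rw [← abs_mul, ← abs_mul]
            exact abs_sub _ _
      _ ≤ 1 * |projPerp c x - projPerp c y| + 4 * α * ℓ * r := by
            gcongr
            exact Real.abs_cos_le_one _
      _ < ℓ * r + 4 * α * ℓ * r := by linarith
      _ ≤ 5 * α * ℓ * r := by nlinarith [mul_pos hℓ hr]
  rw [abs_lt] at hlt
  exact ⟨by linarith [hlt.2], by linarith [hlt.1]⟩

lemma measure_Ioo_le_maximalFn_mul (ν : Measure ℝ) (t : ℝ) {r : ℝ} (hr : 0 < r) :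
    ν (Ioo (t - r) (t + r)) ≤ maximalFn ν t * ENNReal.ofReal (2 * r) := by
  have h0 : ENNReal.ofReal (2 * r) ≠ 0 := (ENNReal.ofReal_pos.2 (by positivity)).ne'
  rw [← ENNReal.div_le_iff h0 ENNReal.ofReal_ne_top]
  exact le_iSup₂ (f := fun (r : ℝ) (_ : 0 < r) =>
    ν (Ioo (t - r) (t + r)) / ENNReal.ofReal (2 * r)) r hr

/-- maximal function bounds give measure bounds on `d_I`-balls. -/
theorem statement9 :
    ∃ C : ℝ, 0 < C ∧
      ∀ (μ : Measure R2), IsLocallyFiniteMeasure μ →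
        ∀ (α M : ℝ) (x : R2) (c ℓ : ℝ),
          1 ≤ α → 0 < ℓ → ℓ ≤ 1 →
          (∃ θ ∈ itv c (α * ℓ), projMaxPerp μ θ x ≤ ENNReal.ofReal M) →
          ∀ r : ℝ, 0 < r → μ (bmet c ℓ x r) ≤ ENNReal.ofReal (C * α * M * ℓ * r) := by
  refine ⟨10, by norm_num, ?_⟩
  intro μ _ α M x c ℓ hα hℓ _ ⟨θ, hθ, hM⟩ r hr
  have hR : 0 < 5 * α * ℓ * r := by positivity
  calc μ (bmet c ℓ x r)
      ≤ μ (projPerp θ ⁻¹'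
          Ioo (projPerp θ x - 5 * α * ℓ * r) (projPerp θ x + 5 * α * ℓ * r)) :=
        measure_mono (bmet_subset_preimage_projPerp x hα hℓ hr hθ)
    _ = μ.map (projPerp θ)
          (Ioo (projPerp θ x - 5 * α * ℓ * r) (projPerp θ x + 5 * α * ℓ * r)) :=
        (Measure.map_apply (measurable_projPerp θ) measurableSet_Ioo).symm
    _ ≤ projMaxPerp μ θ x * ENNReal.ofReal (2 * (5 * α * ℓ * r)) :=
        measure_Ioo_le_maximalFn_mul _ _ hR
    _ ≤ ENNReal.ofReal M * ENNReal.ofReal (2 * (5 * α * ℓ * r)) := by gcongr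
    _ = ENNReal.ofReal (10 * α * M * ℓ * r) := by
        rw [← ENNReal.ofReal_mul' (by positivity)]
        congr 1
        ring

end
end
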